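/- arXiv:2602.18295 — 8 statements merged into one kernel-verified Lean document; each statement's English description precedes it below -/
import Mathlib

section
/- Let ρ be a higher-order GSOS law of Σ over B. Then the operational model (μΣ, ι, γ) is a ρ-bialgebra, and it is an initial object in the category of ρ-bialgebras: for every ρ-bialgebra (X, a, c) there exists a unique ρ-bialgebra morphism from (μΣ, ι, γ) to (X, a, c). -/
open CategoryTheory CategoryTheory.Limits Opposite

universe v u

/-- A free `S`-algebra on an object `X` (providing the object `S*X` of the free monad). -/
structure FreeAlg {C : Type u} [Category.{v} C] (S : C ⥤ C) (X : C) where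
  carrier : C
  emb : X ⟶ carrier
  act : S.obj carrier ⟶ carrier
  desc : ∀ {A : C}, (S.obj A ⟶ A) → (X ⟶ A) → (carrier ⟶ A)
  emb_desc : ∀ {A : C} (a : S.obj A ⟶ A) (h : X ⟶ A), emb ≫ desc a h = h
  act_desc : ∀ {A : C} (a : S.obj A ⟶ A) (h : X ⟶ A),
    act ≫ desc a h = S.map (desc a h) ≫ a
  desc_unique : ∀ {A : C} (a : S.obj A ⟶ A) (h : X ⟶ A) (k : carrier ⟶ A),
    emb ≫ k = h → act ≫ k = S.map k ≫ a → k = desc a h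

/-- An initial `S`-algebra `μS`. -/
structure InitAlg {C : Type u} [Category.{v} C] (S : C ⥤ C) where
  carrier : C
  str : S.obj carrier ⟶ carrier
  fold : ∀ {A : C}, (S.obj A ⟶ A) → (carrier ⟶ A)
  fold_comm : ∀ {A : C} (a : S.obj A ⟶ A), str ≫ fold a = S.map (fold a) ≫ a
  fold_unique : ∀ {A : C} (a : S.obj A ⟶ A) (k : carrier ⟶ A),
    str ≫ k = S.map k ≫ a → k = fold a

variable {C : Type u} [Category.{v} C] [HasBinaryProducts C] [HasBinaryCoproducts C]

/-- The action of the free monad `S*` on a morphism. -/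
def freeMap {S : C ⥤ C} (F : ∀ X : C, FreeAlg S X) {X Y : C} (f : X ⟶ Y) :
    (F X).carrier ⟶ (F Y).carrier :=
  (F X).desc (F Y).act (f ≫ (F Y).emb)

/-- A higher-order GSOS law of `S` over `B`: a family
`ρ_{X,Y} : S(X × B(X,Y)) ⟶ B(X, S*(X+Y))` dinatural in `X` and natural in `Y`. -/
structure HOGSOSLaw (S : C ⥤ C) (B : Cᵒᵖ × C ⥤ C) (F : ∀ X : C, FreeAlg S X) where
  app : ∀ X Y : C, S.obj (X ⨯ B.obj (op X, Y)) ⟶ B.obj (op X, (F (X ⨿ Y)).carrier)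
  dinatural : ∀ {X X' Y : C} (f : X ⟶ X'),
    S.map (prod.map f (𝟙 (B.obj (op X', Y)))) ≫ app X' Y ≫
        B.map ((f.op, 𝟙 ((F (X' ⨿ Y)).carrier)) :
          (op X', (F (X' ⨿ Y)).carrier) ⟶ (op X, (F (X' ⨿ Y)).carrier))
      = S.map (prod.map (𝟙 X) (B.map ((f.op, 𝟙 Y) : (op X', Y) ⟶ (op X, Y)))) ≫ app X Y ≫
        B.map ((𝟙 (op X), freeMap F (coprod.map f (𝟙 Y))) :
          (op X, (F (X ⨿ Y)).carrier) ⟶ (op X, (F (X' ⨿ Y)).carrier))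
  natural : ∀ {X Y Y' : C} (g : Y ⟶ Y'),
    S.map (prod.map (𝟙 X) (B.map ((𝟙 (op X), g) : (op X, Y) ⟶ (op X, Y')))) ≫ app X Y'
      = app X Y ≫ B.map ((𝟙 (op X), freeMap F (coprod.map (𝟙 X) g)) :
          (op X, (F (X ⨿ Y)).carrier) ⟶ (op X, (F (X ⨿ Y')).carrier))

/-- `(X, a, c)` is a `ρ`-bialgebra for the law with components `ρ`. -/
def IsBialgebra (S : C ⥤ C) (B : Cᵒᵖ × C ⥤ C) (F : ∀ X : C, FreeAlg S X)
    (ρ : ∀ X Y : C, S.obj (X ⨯ B.obj (op X, Y)) ⟶ B.obj (op X, (F (X ⨿ Y)).carrier))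
    (X : C) (a : S.obj X ⟶ X) (c : X ⟶ B.obj (op X, X)) : Prop :=
  a ≫ c = S.map (prod.lift (𝟙 X) c) ≫ ρ X X ≫
    B.map ((𝟙 (op X), (F (X ⨿ X)).desc a (coprod.desc (𝟙 X) (𝟙 X))) :
      (op X, (F (X ⨿ X)).carrier) ⟶ (op X, X))

/-- `h` is a morphism of `ρ`-bialgebras. -/
def IsBialgebraHom (S : C ⥤ C) (B : Cᵒᵖ × C ⥤ C)
    {X Y : C} (aX : S.obj X ⟶ X) (cX : X ⟶ B.obj (op X, X))
    (aY : S.obj Y ⟶ Y) (cY : Y ⟶ B.obj (op Y, Y)) (h : X ⟶ Y) : Prop :=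
  aX ≫ h = S.map h ≫ aY ∧
  cX ≫ B.map ((𝟙 (op X), h) : (op X, X) ⟶ (op X, Y))
    = h ≫ cY ≫ B.map ((h.op, 𝟙 Y) : (op Y, Y) ⟶ (op X, Y))

theorem FreeAlg.desc_comp {C : Type u} [Category.{v} C] {S : C ⥤ C} {X : C} (F : FreeAlg S X)
    {A A' : C} {a : S.obj A ⟶ A} {a' : S.obj A' ⟶ A'} (f : X ⟶ A) (h : A ⟶ A')
    (hh : a ≫ h = S.map h ≫ a') : F.desc a f ≫ h = F.desc a' (f ≫ h) := by
  apply F.desc_unique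
  · rw [← Category.assoc, F.emb_desc]
  · rw [← Category.assoc, F.act_desc, Category.assoc, hh, S.map_comp, Category.assoc]

theorem freeMap_desc {C : Type u} [Category.{v} C] {S : C ⥤ C} (F : ∀ X : C, FreeAlg S X)
    {X Y A : C} (f : X ⟶ Y) (a : S.obj A ⟶ A) (g : Y ⟶ A) :
    freeMap F f ≫ (F Y).desc a g = (F X).desc a (f ≫ g) := by
  rw [freeMap, (F X).desc_comp _ _ ((F Y).act_desc a g), Category.assoc, (F Y).emb_desc]

/-- Uniqueness of morphisms defined by primitive recursion out of an initial algebra. -/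
theorem InitAlg.primrec_unique {C : Type u} [Category.{v} C] [HasBinaryProducts C] {S : C ⥤ C}
    (μ : InitAlg S) {A : C} (φ : S.obj (μ.carrier ⨯ A) ⟶ A) {u₁ u₂ : μ.carrier ⟶ A}
    (h₁ : μ.str ≫ u₁ = S.map (prod.lift (𝟙 μ.carrier) u₁) ≫ φ)
    (h₂ : μ.str ≫ u₂ = S.map (prod.lift (𝟙 μ.carrier) u₂) ≫ φ) : u₁ = u₂ := by
  have lift_eq_fold : ∀ u : μ.carrier ⟶ A,
      μ.str ≫ u = S.map (prod.lift (𝟙 μ.carrier) u) ≫ φ →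
      prod.lift (𝟙 μ.carrier) u = μ.fold (prod.lift (S.map prod.fst ≫ μ.str) φ) := by
    intro u hu
    apply μ.fold_unique
    rw [prod.comp_lift, prod.comp_lift, ← hu, ← Category.assoc, ← S.map_comp, prod.lift_fst]
    simp
  have := congrArg (· ≫ prod.snd) ((lift_eq_fold u₁ h₁).trans (lift_eq_fold u₂ h₂).symm)
  simpa only [prod.lift_snd] using this

section Bifunctor

variable {C : Type u} [Category.{v} C] (B : Cᵒᵖ × C ⥤ C)

theorem bifunctor_map_id_comp (X : Cᵒᵖ) {Y Y' Y'' : C} (f : Y ⟶ Y') (g : Y' ⟶ Y'') :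
    B.map ((𝟙 X, f) : (X, Y) ⟶ (X, Y')) ≫ B.map ((𝟙 X, g) : (X, Y') ⟶ (X, Y'')) =
      B.map ((𝟙 X, f ≫ g) : (X, Y) ⟶ (X, Y'')) := by
  rw [← B.map_comp, prod_comp, Category.id_comp]

theorem bifunctor_map_comm {X X' : Cᵒᵖ} {Y Y' : C} (f : X ⟶ X') (g : Y ⟶ Y') :
    B.map ((𝟙 X, g) : (X, Y) ⟶ (X, Y')) ≫ B.map ((f, 𝟙 Y') : (X, Y') ⟶ (X', Y')) =
      B.map ((f, 𝟙 Y) : (X, Y) ⟶ (X', Y)) ≫ B.map ((𝟙 X', g) : (X', Y) ⟶ (X', Y')) := by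
  rw [← B.map_comp, ← B.map_comp, prod_comp, prod_comp]
  simp

end Bifunctor

section Bialgebra

variable {S : C ⥤ C} {B : Cᵒᵖ × C ⥤ C} {F : ∀ X : C, FreeAlg S X} (ρ : HOGSOSLaw S B F)
  {X Y : C} {a : S.obj X ⟶ X} {c : X ⟶ B.obj (op X, X)}
  {b : S.obj Y ⟶ Y} {d : Y ⟶ B.obj (op Y, Y)} {h : X ⟶ Y}

/-- Postcomposing the structure of a bialgebra with an algebra morphism `h : X ⟶ Y` gives a
solution of the recursion equation for morphisms `X ⟶ B(X, Y)`. -/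
theorem IsBialgebra.str_comp_map_right (hc : IsBialgebra S B F ρ.app X a c)
    (hh : a ≫ h = S.map h ≫ b) :
    a ≫ c ≫ B.map ((𝟙 (op X), h) : (op X, X) ⟶ (op X, Y)) =
      S.map (prod.lift (𝟙 X) (c ≫ B.map ((𝟙 (op X), h) : (op X, X) ⟶ (op X, Y)))) ≫
        ρ.app X Y ≫ B.map ((𝟙 (op X), (F (X ⨿ Y)).desc b (coprod.desc h (𝟙 Y))) :
          (op X, (F (X ⨿ Y)).carrier) ⟶ (op X, Y)) := by
  have lift_eq : prod.lift (𝟙 X) (c ≫ B.map ((𝟙 (op X), h) : (op X, X) ⟶ (op X, Y))) =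
      prod.lift (𝟙 X) c ≫ prod.map (𝟙 X) (B.map ((𝟙 (op X), h) : (op X, X) ⟶ (op X, Y))) := by
    simp
  rw [lift_eq, S.map_comp, Category.assoc, reassoc_of% (ρ.natural (X := X) h),
    bifunctor_map_id_comp, freeMap_desc, reassoc_of% hc, bifunctor_map_id_comp,
    FreeAlg.desc_comp _ _ _ hh]
  simp

/-- Transporting the structure of a bialgebra along an algebra morphism `h : X ⟶ Y` into it gives
a solution of the recursion equation for morphisms `X ⟶ B(X, Y)`. -/
theorem IsBialgebra.str_comp_map_left (hd : IsBialgebra S B F ρ.app Y b d)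
    (hh : a ≫ h = S.map h ≫ b) :
    a ≫ h ≫ d ≫ B.map ((h.op, 𝟙 Y) : (op Y, Y) ⟶ (op X, Y)) =
      S.map (prod.lift (𝟙 X) (h ≫ d ≫ B.map ((h.op, 𝟙 Y) : (op Y, Y) ⟶ (op X, Y)))) ≫
        ρ.app X Y ≫ B.map ((𝟙 (op X), (F (X ⨿ Y)).desc b (coprod.desc h (𝟙 Y))) :
          (op X, (F (X ⨿ Y)).carrier) ⟶ (op X, Y)) := by
  have lift_eq : prod.lift (𝟙 X) (h ≫ d ≫ B.map ((h.op, 𝟙 Y) : (op Y, Y) ⟶ (op X, Y))) =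
      prod.lift (𝟙 X) (h ≫ d) ≫
        prod.map (𝟙 X) (B.map ((h.op, 𝟙 Y) : (op Y, Y) ⟶ (op X, Y))) := by
    simp
  have desc_eq : (F (X ⨿ Y)).desc b (coprod.desc h (𝟙 Y)) =
      freeMap F (coprod.map h (𝟙 Y)) ≫ (F (Y ⨿ Y)).desc b (coprod.desc (𝟙 Y) (𝟙 Y)) := by
    rw [freeMap_desc]
    simp
  have map_lift_eq : S.map h ≫ S.map (prod.lift (𝟙 Y) d) =
      S.map (prod.lift (𝟙 X) (h ≫ d)) ≫ S.map (prod.map h (𝟙 (B.obj (op Y, Y)))) := by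
    rw [← S.map_comp, ← S.map_comp]
    simp
  rw [lift_eq, desc_eq, ← bifunctor_map_id_comp, S.map_comp, Category.assoc,
    ← reassoc_of% (ρ.dinatural (Y := Y) h), reassoc_of% hh, reassoc_of% hd,
    bifunctor_map_comm, reassoc_of% map_lift_eq]

end Bialgebra

/-- The operational model `(μΣ, ι, γ)` of a higher-order GSOS law `ρ`
is a `ρ`-bialgebra and is initial in the category of `ρ`-bialgebras. -/
theorem operational_model_is_initial_bialgebra
    (S : C ⥤ C) (B : Cᵒᵖ × C ⥤ C) (F : ∀ X : C, FreeAlg S X)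
    (μ : InitAlg S) (ρ : HOGSOSLaw S B F)
    (γ : μ.carrier ⟶ B.obj (op μ.carrier, μ.carrier))
    (hγ : μ.str ≫ γ = S.map (prod.lift (𝟙 μ.carrier) γ) ≫ ρ.app μ.carrier μ.carrier ≫
      B.map ((𝟙 (op μ.carrier),
          (F (μ.carrier ⨿ μ.carrier)).desc μ.str (coprod.desc (𝟙 μ.carrier) (𝟙 μ.carrier))) :
        (op μ.carrier, (F (μ.carrier ⨿ μ.carrier)).carrier) ⟶ (op μ.carrier, μ.carrier))) :
    IsBialgebra S B F ρ.app μ.carrier μ.str γ ∧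
    ∀ (X : C) (a : S.obj X ⟶ X) (c : X ⟶ B.obj (op X, X)),
      IsBialgebra S B F ρ.app X a c →
      ∃! h : μ.carrier ⟶ X, IsBialgebraHom S B μ.str γ a c h := by
  refine ⟨hγ, fun X a c hc => ⟨μ.fold a, ⟨μ.fold_comm a, ?_⟩, fun k hk =>
    μ.fold_unique a k hk.1⟩⟩
  exact μ.primrec_unique _ (IsBialgebra.str_comp_map_right ρ hγ (μ.fold_comm a))
    (IsBialgebra.str_comp_map_left ρ hc (μ.fold_comm a))
end

section
/- Fixed point theorem for M-categories: Let C be an M-category with a terminal object 1 and inverse limits of increasing Cauchy towers, let F : C^op → C be a locally contractive functor, and suppose the hom-set C(1, F1) is inhabited. Then F has a fixed point: there exists an object X of C with an isomorphism FX ≅ X. Moreover, if all hom-sets of C are inhabited, then any two fixed points of F are isomorphic. -/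
open CategoryTheory CategoryTheory.Limits Opposite

universe v u

/-- An M-category structure on a category `C`: every hom-set carries a complete,
1-bounded ultrametric, and composition is non-expansive. -/
structure MCategoryStruct (C : Type u) [Category.{v} C] where
  d : ∀ {A B : C}, (A ⟶ B) → (A ⟶ B) → ℝ
  d_nonneg : ∀ {A B : C} (f g : A ⟶ B), 0 ≤ d f g
  d_self : ∀ {A B : C} (f : A ⟶ B), d f f = 0
  d_comm : ∀ {A B : C} (f g : A ⟶ B), d f g = d g f
  eq_of_d_eq_zero : ∀ {A B : C} {f g : A ⟶ B}, d f g = 0 → f = g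
  d_ultra : ∀ {A B : C} (f g h : A ⟶ B), d f h ≤ max (d f g) (d g h)
  d_bounded : ∀ {A B : C} (f g : A ⟶ B), d f g ≤ 1
  complete : ∀ {A B : C} (u : ℕ → (A ⟶ B)),
    (∀ ε : ℝ, 0 < ε → ∃ N : ℕ, ∀ m n : ℕ, N ≤ m → N ≤ n → d (u m) (u n) < ε) →
    ∃ f : A ⟶ B, ∀ ε : ℝ, 0 < ε → ∃ N : ℕ, ∀ n : ℕ, N ≤ n → d (u n) f < ε
  comp_nonexpansive : ∀ {A B D : C} (f g : A ⟶ B) (f' g' : B ⟶ D),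
    d (f ≫ f') (g ≫ g') ≤ max (d f g) (d f' g')

/-- `C` has inverse limits of increasing Cauchy towers: for every tower
`(A_n, f_n : A_n ⟶ A_{n+1}, g_n : A_{n+1} ⟶ A_n)` with `g_n ∘ f_n = id` and
`d(f_n ∘ g_n, id) → 0`, the `ω^op`-chain given by the `g_n` has a limit. -/
def HasCauchyTowerLimits {C : Type u} [Category.{v} C] (M : MCategoryStruct C) : Prop :=
  ∀ (A : ℕ → C) (f : ∀ n, A n ⟶ A (n + 1)) (g : ∀ n, A (n + 1) ⟶ A n),
    (∀ n, f n ≫ g n = 𝟙 (A n)) →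
    (∀ ε : ℝ, 0 < ε → ∃ N : ℕ, ∀ n : ℕ, N ≤ n → M.d (g n ≫ f n) (𝟙 (A (n + 1))) < ε) →
    ∃ (L : C) (π : ∀ n, L ⟶ A n),
      (∀ n, π (n + 1) ≫ g n = π n) ∧
      ∀ (L' : C) (π' : ∀ n, L' ⟶ A n), (∀ n, π' (n + 1) ≫ g n = π' n) →
        ∃! u : L' ⟶ L, ∀ n, u ≫ π n = π' n

namespace MCategoryStruct

variable {C : Type u} [Category.{v} C] (M : MCategoryStruct C)

lemma d_comp_left_le {A B D : C} (h : A ⟶ B) (f g : B ⟶ D) :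
    M.d (h ≫ f) (h ≫ g) ≤ M.d f g :=
  (M.comp_nonexpansive h h f g).trans
    (max_le ((M.d_self h).le.trans (M.d_nonneg f g)) le_rfl)

lemma d_comp_right_le {A B D : C} (f g : A ⟶ B) (h : B ⟶ D) :
    M.d (f ≫ h) (g ≫ h) ≤ M.d f g :=
  (M.comp_nonexpansive f g h h).trans
    (max_le le_rfl ((M.d_self h).le.trans (M.d_nonneg f g)))

lemma d_comp_comp_le {A B D E : C} (h : A ⟶ B) (f g : B ⟶ D) (k : D ⟶ E) :
    M.d (h ≫ f ≫ k) (h ≫ g ≫ k) ≤ M.d f g :=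
  (M.d_comp_left_le h _ _).trans (M.d_comp_right_le f g k)

lemma eq_of_d_le_pow {c : ℝ} (hc0 : 0 ≤ c) (hc1 : c < 1) {A B : C} {f g : A ⟶ B} (N : ℕ)
    (h : ∀ n, N ≤ n → M.d f g ≤ c ^ n) : f = g := by
  refine M.eq_of_d_eq_zero (le_antisymm ?_ (M.d_nonneg f g))
  exact ge_of_tendsto (tendsto_pow_atTop_nhds_zero_of_lt_one hc0 hc1)
    (Filter.eventually_atTop.2 ⟨N, h⟩)

lemma d_le_pow_of_le {c : ℝ} (hc0 : 0 ≤ c) (hc1 : c < 1) {A B : C} {u : ℕ → (A ⟶ B)}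
    (h : ∀ n, M.d (u n) (u (n + 1)) ≤ c ^ n) {m n : ℕ} (hmn : m ≤ n) :
    M.d (u m) (u n) ≤ c ^ m := by
  induction n, hmn using Nat.le_induction with
  | base => exact (M.d_self _).le.trans (pow_nonneg hc0 m)
  | succ n hmn ih =>
    exact (M.d_ultra _ (u n) _).trans
      (max_le ih ((h n).trans (pow_le_pow_of_le_one hc0 hc1.le hmn)))

/-- A sequence whose consecutive distances are bounded by `c ^ n` converges at that rate. -/
lemma exists_limit_of_d_le_pow {c : ℝ} (hc0 : 0 ≤ c) (hc1 : c < 1) {A B : C}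
    {u : ℕ → (A ⟶ B)} (h : ∀ n, M.d (u n) (u (n + 1)) ≤ c ^ n) :
    ∃ f : A ⟶ B, ∀ n, M.d (u n) f ≤ c ^ n := by
  obtain ⟨f, hf⟩ := M.complete u fun ε hε => by
    obtain ⟨N, hN⟩ := exists_pow_lt_of_lt_one hε hc1
    refine ⟨N, fun m n hm hn => lt_of_le_of_lt ?_ hN⟩
    refine (M.d_ultra _ (u N) _).trans (max_le ?_ (M.d_le_pow_of_le hc0 hc1 h hn))
    rw [M.d_comm]
    exact M.d_le_pow_of_le hc0 hc1 h hm
  refine ⟨f, fun n => le_of_forall_pos_le_add fun ε hε => ?_⟩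
  obtain ⟨N, hN⟩ := hf ε hε
  have hpow : 0 ≤ c ^ n := pow_nonneg hc0 n
  refine (M.d_ultra _ (u (max n N)) _).trans (max_le ?_ ?_)
  · exact (M.d_le_pow_of_le hc0 hc1 h (le_max_left n N)).trans (by linarith)
  · exact (hN _ (le_max_right n N)).le.trans (by linarith)

/-- Banach's fixed point theorem on a hom-set. -/
lemma exists_fixed_of_contracting {c : ℝ} (hc0 : 0 ≤ c) (hc1 : c < 1) {A B : C}
    (T : (A ⟶ B) → (A ⟶ B)) (hT : ∀ f g, M.d (T f) (T g) ≤ c * M.d f g) (x : A ⟶ B) :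
    ∃ f, T f = f := by
  have hx : ∀ n, M.d (T^[n] x) (T^[n + 1] x) ≤ c ^ n := by
    intro n
    induction n with
    | zero => simpa using M.d_bounded _ _
    | succ n ih =>
      rw [Function.iterate_succ_apply' T n, Function.iterate_succ_apply' T (n + 1), pow_succ']
      exact (hT _ _).trans (mul_le_mul_of_nonneg_left ih hc0)
  obtain ⟨f, hf⟩ := M.exists_limit_of_d_le_pow hc0 hc1 hx
  refine ⟨f, M.eq_of_d_le_pow hc0 hc1 0 fun n _ => ?_⟩
  refine (M.d_ultra _ (T (T^[n] x)) _).trans (max_le ?_ ?_)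
  · refine (hT _ _).trans ((mul_le_of_le_one_left (M.d_nonneg _ _) hc1.le).trans ?_)
    rw [M.d_comm]
    exact hf n
  · rw [← Function.iterate_succ_apply' T n]
    exact (hf (n + 1)).trans (pow_le_pow_of_le_one hc0 hc1.le n.le_succ)

lemma fixed_unique_of_contracting {c : ℝ} (hc1 : c < 1) {A B : C}
    (T : (A ⟶ B) → (A ⟶ B)) (hT : ∀ f g, M.d (T f) (T g) ≤ c * M.d f g) {f g : A ⟶ B}
    (hf : T f = f) (hg : T g = g) : f = g := by
  have h := hT f g
  rw [hf, hg] at h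
  exact M.eq_of_d_eq_zero (by nlinarith [M.d_nonneg f g])

/-- A morphism transported along a contravariant functor between two of its fixed points. -/
def conj (F : Cᵒᵖ ⥤ C) {X Y : C} (i : F.obj (op X) ≅ X) (j : F.obj (op Y) ≅ Y) (g : Y ⟶ X) :
    X ⟶ Y :=
  i.inv ≫ F.map g.op ≫ j.hom

lemma conj_comp_conj (F : Cᵒᵖ ⥤ C) {X Y Z : C} (i : F.obj (op X) ≅ X) (j : F.obj (op Y) ≅ Y)
    (k : F.obj (op Z) ≅ Z) (g : Y ⟶ X) (h : Z ⟶ Y) :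
    conj F i j g ≫ conj F j k h = conj F i k (h ≫ g) := by
  simp [conj]

lemma conj_id (F : Cᵒᵖ ⥤ C) {X : C} (i : F.obj (op X) ≅ X) : conj F i i (𝟙 X) = 𝟙 X := by
  simp [conj]

section LocallyContractive

variable {M} {F : Cᵒᵖ ⥤ C} {c : ℝ}

lemma d_conj_le (hF : ∀ {A B : C} (f g : A ⟶ B), M.d (F.map f.op) (F.map g.op) ≤ c * M.d f g)
    {X Y : C} (i : F.obj (op X) ≅ X) (j : F.obj (op Y) ≅ Y) (g h : Y ⟶ X) :
    M.d (conj F i j g) (conj F i j h) ≤ c * M.d g h :=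
  (M.d_comp_comp_le _ _ _ _).trans (hF g h)

/-- Fixed points of a locally contractive functor with morphisms both ways are isomorphic. -/
lemma nonempty_iso_of_fixed (hc0 : 0 ≤ c) (hc1 : c < 1)
    (hF : ∀ {A B : C} (f g : A ⟶ B), M.d (F.map f.op) (F.map g.op) ≤ c * M.d f g)
    {X Y : C} (i : F.obj (op X) ≅ X) (j : F.obj (op Y) ≅ Y) (x : X ⟶ Y) :
    Nonempty (X ≅ Y) := by
  obtain ⟨f, hf⟩ := M.exists_fixed_of_contracting hc0 hc1
    (fun f => conj F i j (conj F j i f)) (fun f g =>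
      (d_conj_le hF i j _ _).trans (mul_le_mul_of_nonneg_left
        ((d_conj_le hF j i f g).trans (mul_le_of_le_one_left (M.d_nonneg _ _) hc1.le)) hc0)) x
  refine ⟨⟨f, conj F j i f, ?_, ?_⟩⟩
  · refine M.fixed_unique_of_contracting hc1 (conj F i i) (d_conj_le hF i i) ?_ (conj_id F i)
    rw [← conj_comp_conj F i j i, hf]
  · refine M.fixed_unique_of_contracting hc1 (conj F j j) (d_conj_le hF j j) ?_ (conj_id F j)
    rw [← conj_comp_conj F j i j, hf]

end LocallyContractive

end MCategoryStruct

namespace ContravariantTower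

variable {C : Type u} [Category.{v} C] [HasTerminal C] (F : Cᵒᵖ ⥤ C)

/-- The iterates of `F` on the terminal object. -/
noncomputable def obj : ℕ → C
  | 0 => ⊤_ C
  | n + 1 => F.obj (op (obj n))

variable {F}

/-- The action of `F` on morphisms between iterates. -/
noncomputable def lift {m n : ℕ} (f : obj F m ⟶ obj F n) : obj F (n + 1) ⟶ obj F (m + 1) :=
  F.map f.op

/-- The action of `F` on morphisms out of an iterate. -/
noncomputable def liftOut {n : ℕ} {X : C} (f : obj F n ⟶ X) : F.obj (op X) ⟶ obj F (n + 1) :=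
  F.map f.op

/-- The action of `F` on morphisms into an iterate. -/
noncomputable def liftInto {n : ℕ} {X : C} (f : X ⟶ obj F n) : obj F (n + 1) ⟶ F.obj (op X) :=
  F.map f.op

lemma lift_comp {m n k : ℕ} (f : obj F m ⟶ obj F n) (g : obj F n ⟶ obj F k) :
    lift g ≫ lift f = lift (f ≫ g) :=
  (F.map_comp g.op f.op).symm

lemma lift_id (n : ℕ) : lift (𝟙 (obj F n)) = 𝟙 (obj F (n + 1)) :=
  F.map_id (op (obj F n))

lemma liftOut_comp_lift {m n : ℕ} {X : C} (f : obj F m ⟶ obj F n) (g : obj F n ⟶ X) :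
    liftOut g ≫ lift f = liftOut (f ≫ g) :=
  (F.map_comp g.op f.op).symm

lemma lift_comp_liftInto {m n : ℕ} {X : C} (f : X ⟶ obj F m) (g : obj F m ⟶ obj F n) :
    lift g ≫ liftInto f = liftInto (f ≫ g) :=
  (F.map_comp g.op f.op).symm

lemma liftInto_comp_liftOut {m n : ℕ} {X : C} (f : obj F m ⟶ X) (g : X ⟶ obj F n) :
    liftInto g ≫ liftOut f = lift (f ≫ g) :=
  (F.map_comp g.op f.op).symm

lemma liftOut_comp_liftInto {n : ℕ} {X : C} (f : X ⟶ obj F n) (g : obj F n ⟶ X) :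
    liftOut g ≫ liftInto f = F.map (f ≫ g).op :=
  (F.map_comp g.op f.op).symm

lemma hom_zero_ext {X : C} (f g : X ⟶ obj F 0) : f = g :=
  Subsingleton.elim (α := X ⟶ ⊤_ C) f g

/-- The unique morphism to the terminal object, seen as the zeroth iterate. -/
noncomputable def toZero (X : C) : X ⟶ obj F 0 := terminal.from X

variable (s : obj F 0 ⟶ obj F 1)

/-- The embedding and the projection between consecutive iterates. -/
noncomputable def maps : ∀ n, (obj F n ⟶ obj F (n + 1)) × (obj F (n + 1) ⟶ obj F n)
  | 0 => (s, toZero _)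
  | n + 1 => (lift (maps n).2, lift (maps n).1)

/-- The embedding of each iterate into the next one. -/
noncomputable def emb (n : ℕ) : obj F n ⟶ obj F (n + 1) := (maps s n).1

/-- The projection of each iterate onto the previous one. -/
noncomputable def proj (n : ℕ) : obj F (n + 1) ⟶ obj F n := (maps s n).2

/-- The canonical morphism between any two iterates. -/
noncomputable def trans : ∀ n m, obj F n ⟶ obj F m
  | _, 0 => toZero _
  | 0, _ + 1 => s ≫ lift (toZero _)
  | n + 1, m + 1 => lift (trans m n)
termination_by n m => n + m

lemma emb_zero : emb s 0 = s := rfl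

lemma emb_succ (n : ℕ) : emb s (n + 1) = lift (proj s n) := rfl

lemma proj_succ (n : ℕ) : proj s (n + 1) = lift (emb s n) := rfl

lemma trans_zero_succ (m : ℕ) :
    trans s 0 (m + 1) = s ≫ lift (toZero (obj F m)) := by
  rw [trans]

lemma trans_succ_succ (n m : ℕ) : trans s (n + 1) (m + 1) = lift (trans s m n) := by
  rw [trans]

lemma emb_proj (n : ℕ) : emb s n ≫ proj s n = 𝟙 (obj F n) := by
  induction n with
  | zero => exact hom_zero_ext _ _
  | succ n ih =>
    rw [emb_succ, proj_succ, lift_comp, ih, lift_id]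

lemma trans_self (n : ℕ) : trans s n n = 𝟙 (obj F n) := by
  induction n with
  | zero => exact hom_zero_ext _ _
  | succ n ih =>
    rw [trans_succ_succ, ih, lift_id]

lemma trans_proj_and_emb_trans (n m : ℕ) :
    trans s n (m + 1) ≫ proj s m = trans s n m ∧
      emb s m ≫ trans s (m + 1) n = trans s m n := by
  induction n generalizing m with
  | zero =>
    refine ⟨?_, hom_zero_ext _ _⟩
    cases m with
    | zero => exact hom_zero_ext _ _
    | succ m =>
      rw [trans_zero_succ, trans_zero_succ, proj_succ, Category.assoc, lift_comp]
      congr 2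
      exact hom_zero_ext _ _
  | succ n ih =>
    cases m with
    | zero =>
      refine ⟨hom_zero_ext _ _, ?_⟩
      rw [trans_succ_succ, trans_zero_succ, emb_zero]
      congr 2
      exact hom_zero_ext _ _
    | succ m =>
      constructor
      · rw [trans_succ_succ, trans_succ_succ, proj_succ, lift_comp, (ih m).2]
      · rw [trans_succ_succ, trans_succ_succ, emb_succ, lift_comp, (ih m).1]

lemma trans_proj (n m : ℕ) : trans s n (m + 1) ≫ proj s m = trans s n m :=
  (trans_proj_and_emb_trans s n m).1

lemma emb_trans (n m : ℕ) : emb s n ≫ trans s (n + 1) m = trans s n m :=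
  (trans_proj_and_emb_trans s m n).2

lemma proj_trans_and_trans_emb {m n : ℕ} (h : m ≤ n) :
    proj s n ≫ trans s n m = trans s (n + 1) m ∧
      trans s m n ≫ emb s n = trans s m (n + 1) := by
  induction m generalizing n with
  | zero =>
    refine ⟨hom_zero_ext _ _, ?_⟩
    cases n with
    | zero =>
      rw [trans_self, Category.id_comp, trans_zero_succ, emb_zero,
        hom_zero_ext (toZero (obj F 0)) (𝟙 _), lift_id, Category.comp_id]
    | succ n =>
      rw [trans_zero_succ, trans_zero_succ, emb_succ, Category.assoc, lift_comp]
      congr 2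
      exact hom_zero_ext _ _
  | succ m ih =>
    cases n with
    | zero => omega
    | succ n =>
      have hmn := ih (n := n) (by omega)
      constructor
      · rw [trans_succ_succ, trans_succ_succ, proj_succ, lift_comp, hmn.2]
      · rw [trans_succ_succ, trans_succ_succ, emb_succ, lift_comp, hmn.1]

lemma proj_trans {m n : ℕ} (h : m ≤ n) : proj s n ≫ trans s n m = trans s (n + 1) m :=
  (proj_trans_and_trans_emb s h).1

lemma d_proj_emb_le (M : MCategoryStruct C) {c : ℝ} (hc0 : 0 ≤ c)
    (hF : ∀ {A B : C} (f g : A ⟶ B), M.d (F.map f.op) (F.map g.op) ≤ c * M.d f g) (n : ℕ) :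
    M.d (proj s n ≫ emb s n) (𝟙 (obj F (n + 1))) ≤ c ^ n := by
  induction n with
  | zero => simpa using M.d_bounded _ _
  | succ n ih =>
    rw [emb_succ, proj_succ, lift_comp, ← lift_id, pow_succ']
    exact (hF _ _).trans (mul_le_mul_of_nonneg_left ih hc0)

/-- The inverse limit of the iterates of `F` is a fixed point of `F`. -/
lemma exists_fixed (s : obj F 0 ⟶ obj F 1) (M : MCategoryStruct C)
    (hlim : HasCauchyTowerLimits M) {c : ℝ} (hc0 : 0 ≤ c) (hc1 : c < 1)
    (hF : ∀ {A B : C} (f g : A ⟶ B), M.d (F.map f.op) (F.map g.op) ≤ c * M.d f g) :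
    ∃ X : C, Nonempty (F.obj (op X) ≅ X) := by
  have hd := d_proj_emb_le s M hc0 hF
  obtain ⟨L, π, hπ, hL⟩ := hlim (obj F) (emb s) (proj s) (emb_proj s) fun ε hε => by
    obtain ⟨N, hN⟩ := exists_pow_lt_of_lt_one hε hc1
    exact ⟨N, fun n hn =>
      ((hd n).trans (pow_le_pow_of_le_one hc0 hc1.le hn)).trans_lt hN⟩
  have hext : ∀ {Z : C} {a b : Z ⟶ L}, (∀ n, a ≫ π n = b ≫ π n) → a = b := by
    intro Z a b hab
    exact (hL Z (fun n => b ≫ π n) fun n => by rw [Category.assoc, hπ]).unique hab fun _ => rfl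
  have hι : ∀ n, ∃ ι : obj F n ⟶ L, ∀ m, ι ≫ π m = trans s n m := fun n =>
    (hL _ (trans s n) (trans_proj s n)).exists
  choose ι hι using hι
  have hemb : ∀ n, emb s n ≫ ι (n + 1) = ι n := fun n => hext fun m => by
    rw [Category.assoc, hι, hι, emb_trans]
  have hπtrans : ∀ m n, m ≤ n → π n ≫ trans s n m = π m := by
    intro m n hmn
    induction n, hmn using Nat.le_induction with
    | base => rw [trans_self, Category.comp_id]
    | succ n hmn ih => rw [← proj_trans s hmn, ← Category.assoc, hπ, ih]
  have hπι : ∀ n, M.d (π n ≫ ι n) (𝟙 L) ≤ c ^ n := by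
    obtain ⟨t, ht⟩ := M.exists_limit_of_d_le_pow hc0 hc1 (u := fun n => π n ≫ ι n) fun n => by
      have h := M.d_comp_comp_le (π (n + 1)) (proj s n ≫ emb s n) (𝟙 _) (ι (n + 1))
      rw [Category.assoc, hemb, Category.id_comp, ← Category.assoc, hπ] at h
      exact h.trans (hd n)
    suffices t = 𝟙 L from this ▸ ht
    refine hext fun m => M.eq_of_d_le_pow hc0 hc1 m fun n hmn => ?_
    have h := M.d_comp_right_le (π n ≫ ι n) t (π m)
    rw [Category.assoc, hι, hπtrans m n hmn, M.d_comm] at h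
    rw [Category.id_comp]
    exact h.trans (ht n)
  obtain ⟨w, hw⟩ : ∃ w : F.obj (op L) ⟶ L, ∀ n, w ≫ π (n + 1) = liftOut (ι n) := by
    obtain ⟨w, hw, -⟩ := hL (F.obj (op L))
      (fun n => match n with
        | 0 => toZero _
        | n + 1 => liftOut (ι n))
      (fun n => match n with
        | 0 => hom_zero_ext _ _
        | n + 1 => by
          change liftOut (ι (n + 1)) ≫ proj s (n + 1) = liftOut (ι n)
          rw [proj_succ, liftOut_comp_lift, hemb])
    exact ⟨w, fun n => hw (n + 1)⟩
  have hFw : ∀ n, liftInto (π n) ≫ w = ι (n + 1) := fun n => hext fun m => by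
    cases m with
    | zero => exact hom_zero_ext _ _
    | succ m => rw [Category.assoc, hw, liftInto_comp_liftOut, hι, hι, trans_succ_succ]
  obtain ⟨z, hz⟩ : ∃ z : L ⟶ F.obj (op L),
      ∀ n, M.d (π (n + 1) ≫ liftInto (π n)) z ≤ c ^ n := by
    refine M.exists_limit_of_d_le_pow hc0 hc1
      (u := fun n => π (n + 1) ≫ liftInto (π n)) fun n => ?_
    have h := M.d_comp_comp_le (π (n + 2)) (proj s (n + 1) ≫ emb s (n + 1)) (𝟙 _)
      (liftInto (π (n + 1)))
    have h1 : emb s (n + 1) ≫ liftInto (π (n + 1)) = liftInto (π n) := by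
      rw [emb_succ, lift_comp_liftInto, hπ]
    have h2 : π (n + 2) ≫ (proj s (n + 1) ≫ emb s (n + 1)) ≫ liftInto (π (n + 1)) =
        π (n + 1) ≫ liftInto (π n) := by
      rw [Category.assoc, h1, ← Category.assoc, hπ]
    have h3 : 𝟙 (obj F (n + 2)) ≫ liftInto (π (n + 1)) = liftInto (π (n + 1)) :=
      Category.id_comp _
    rw [h2, h3] at h
    exact h.trans ((hd (n + 1)).trans (pow_le_pow_of_le_one hc0 hc1.le n.le_succ))
  refine ⟨L, ⟨⟨w, z, ?_, ?_⟩⟩⟩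
  · refine M.eq_of_d_le_pow hc0 hc1 0 fun n _ => ?_
    refine (M.d_ultra _ (w ≫ π (n + 1) ≫ liftInto (π n)) _).trans (max_le ?_ ?_)
    · rw [M.d_comm]
      exact (M.d_comp_left_le w _ _).trans (hz n)
    · rw [← Category.assoc, hw, liftOut_comp_liftInto, ← F.map_id, ← op_id]
      exact (hF _ _).trans
        ((mul_le_of_le_one_left (M.d_nonneg _ _) hc1.le).trans (hπι n))
  · refine M.eq_of_d_le_pow hc0 hc1 0 fun n _ => ?_
    refine (M.d_ultra _ ((π (n + 1) ≫ liftInto (π n)) ≫ w) _).trans (max_le ?_ ?_)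
    · rw [M.d_comm]
      exact (M.d_comp_right_le _ _ w).trans (hz n)
    · rw [Category.assoc, hFw]
      exact (hπι (n + 1)).trans (pow_le_pow_of_le_one hc0 hc1.le n.le_succ)

end ContravariantTower

/-- **Fixed point theorem for M-categories.** Let `C` be an M-category
with a terminal object and inverse limits of increasing Cauchy towers, let
`F : Cᵒᵖ ⥤ C` be locally contractive, and suppose `C(1, F1)` is inhabited. Then `F`
has a fixed point `FX ≅ X`; and if all hom-sets of `C` are inhabited, any two fixed
points of `F` are isomorphic. -/
theorem m_category_fixed_point
    {C : Type u} [Category.{v} C] [HasTerminal C] (M : MCategoryStruct C)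
    (hlim : HasCauchyTowerLimits M)
    (F : Cᵒᵖ ⥤ C)
    (c : ℝ) (hc0 : 0 ≤ c) (hc1 : c < 1)
    (hF : ∀ {A B : C} (f g : A ⟶ B), M.d (F.map f.op) (F.map g.op) ≤ c * M.d f g)
    (hseed : Nonempty ((⊤_ C) ⟶ F.obj (op (⊤_ C)))) :
    (∃ X : C, Nonempty (F.obj (op X) ≅ X)) ∧
    ((∀ A B : C, Nonempty (A ⟶ B)) →
      ∀ (X Y : C), (F.obj (op X) ≅ X) → (F.obj (op Y) ≅ Y) → Nonempty (X ≅ Y)) := by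
  exact ⟨ContravariantTower.exists_fixed hseed.some M hlim hc0 hc1 hF,
    fun hne X Y i j => MCategoryStruct.nonempty_iso_of_fixed hc0 hc1 hF i j (hne X Y).some⟩
end

section
/- The xTCL behaviour bifunctor B on Set^Ty has no final higher-order coalgebra: there exists no higher-order B-coalgebra (T, t) such that for every higher-order B-coalgebra (C, c) there is a unique morphism of higher-order B-coalgebras from (C, c) to (T, t). -/
universe u

/-- Simple types: `Ty ::= unit | Ty → Ty`. -/
inductive Ty : Type
  | unit : Ty
  | arrow : Ty → Ty → Ty

/-- `Ty`-sorted sets, the objects of `Set^Ty`. -/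
abbrev TySet := Ty → Type u

/-- `Ty`-sorted functions, the morphisms of `Set^Ty`. -/
abbrev TyHom (A B : TySet.{u}) := ∀ τ : Ty, A τ → B τ

/-- Identity morphism of `Set^Ty`. -/
def tyId (A : TySet.{u}) : TyHom A A := fun _ x => x

/-- Composition in `Set^Ty` (diagrammatic order). -/
def tyComp {A B C : TySet.{u}} (f : TyHom A B) (g : TyHom B C) : TyHom A C :=
  fun τ x => g τ (f τ x)

/-- The xTCL behaviour bifunctor on objects:
`B_unit(X,Y) = Y_unit + 1`, `B_{τ₁→τ₂}(X,Y) = Y_{τ₁→τ₂} + Y_{τ₂}^{X_{τ₁}}`. -/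
def BObj (X Y : TySet.{u}) : TySet.{u} := fun τ =>
  match τ with
  | .unit => Y .unit ⊕ PUnit
  | .arrow τ₁ τ₂ => Y (.arrow τ₁ τ₂) ⊕ (X τ₁ → Y τ₂)

/-- The action of the bifunctor `B` on morphisms: contravariant in the first
argument, covariant in the second one. -/
def BMap {X X' Y Y' : TySet.{u}} (f : TyHom X' X) (g : TyHom Y Y') :
    TyHom (BObj X Y) (BObj X' Y')
  | .unit, .inl y => .inl (g .unit y)
  | .unit, .inr u => .inr u
  | .arrow τ₁ τ₂, .inl y => .inl (g (.arrow τ₁ τ₂) y)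
  | .arrow τ₁ τ₂, .inr φ => .inr (fun x => g τ₂ (φ (f τ₁ x)))

/-- `h` is a morphism of higher-order `B`-coalgebras `(X,c) → (Y,d)`:
`B(id_X, h) ∘ c = B(h, id_Y) ∘ d ∘ h`. -/
def IsHOCoalgHom {X Y : TySet.{u}} (c : TyHom X (BObj X X)) (d : TyHom Y (BObj Y Y))
    (h : TyHom X Y) : Prop :=
  ∀ (τ : Ty) (x : X τ), BMap (tyId X) h τ (c τ x) = BMap h (tyId Y) τ (d τ (h τ x))

/-- The `Ty`-sorted set with `A` at sort `unit`, `F` at sort `unit → unit`, and nothing elsewhere. -/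
def lowSorts (A F : Type u) : TySet.{u}
  | .unit => A
  | .arrow .unit .unit => F
  | .arrow .unit (.arrow _ _) => PEmpty
  | .arrow (.arrow _ _) _ => PEmpty

/-- The coalgebra on `lowSorts A F` in which every element of `F` acts as a function on `A`. -/
def lowCoalg {A F : Type u} (a : A → A ⊕ PUnit.{u + 1}) (f : F → A → A) :
    TyHom (lowSorts A F) (BObj (lowSorts A F) (lowSorts A F))
  | .unit, x => a x
  | .arrow .unit .unit, x => .inr (f x)
  | .arrow .unit (.arrow _ _), x => x.elim
  | .arrow (.arrow _ _) _, x => x.elim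

/-- The morphism out of `lowSorts A F` determined by its two nontrivial components. -/
def lowHom {A F : Type u} {T : TySet.{u}} (a : A → T .unit) (f : F → T (.arrow .unit .unit)) :
    TyHom (lowSorts A F) T
  | .unit, x => a x
  | .arrow .unit .unit, x => f x
  | .arrow .unit (.arrow _ _), x => x.elim
  | .arrow (.arrow _ _) _, x => x.elim

/-- With nothing at sort `unit`, any element of `T` behaving as a function gives a morphism. -/
lemma isHOCoalgHom_lowHom_of_inr {T : TySet.{u}} (t : TyHom T (BObj T T))
    (x : T (.arrow .unit .unit)) (ψ : T .unit → T .unit)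
    (hx : t (.arrow .unit .unit) x = .inr ψ) :
    IsHOCoalgHom (lowCoalg (A := PEmpty) (F := PUnit) PEmpty.elim fun _ => id) t
      (lowHom PEmpty.elim fun _ => x) := by
  intro τ y
  match τ, y with
  | .unit, y => exact y.elim
  | .arrow .unit .unit, _ =>
    change _ = BMap _ _ _ (t (.arrow .unit .unit) x)
    rw [hx]
    exact congrArg Sum.inr (funext fun z : PEmpty => z.elim)
  | .arrow .unit (.arrow _ _), y => exact y.elim
  | .arrow (.arrow _ _) _, y => exact y.elim

/-- An element whose image behaves as a function `φ` is sent to one behaving as a function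
that extends `φ` along the morphism. -/
lemma IsHOCoalgHom.exists_inr {X Y : TySet.{u}} {c : TyHom X (BObj X X)}
    {d : TyHom Y (BObj Y Y)} {h : TyHom X Y} (hh : IsHOCoalgHom c d h) {σ τ : Ty}
    {x : X (.arrow σ τ)} {φ : X σ → X τ} (hx : c (.arrow σ τ) x = .inr φ) :
    ∃ ψ : Y σ → Y τ, d (.arrow σ τ) (h _ x) = .inr ψ ∧ ∀ z, ψ (h σ z) = h τ (φ z) := by
  have key := hh _ x
  rw [hx] at key
  generalize d (.arrow σ τ) (h _ x) = w at key ⊢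
  match w, key with
  | .inl _, key => exact (Sum.inr_ne_inl key).elim
  | .inr ψ, key => exact ⟨ψ, rfl, fun z => (congrFun (Sum.inr.inj key) z).symm⟩

/-- The xTCL behaviour bifunctor `B` on `Set^Ty` has no final
higher-order coalgebra. -/
theorem no_final_higher_order_coalgebra :
    ¬ ∃ (T : TySet.{u}) (t : TyHom T (BObj T T)),
        ∀ (C : TySet.{u}) (c : TyHom C (BObj C C)),
          ∃! h : TyHom C T, IsHOCoalgHom c t h := by
  rintro ⟨T, t, final⟩
  let a : ULift.{u} Bool → ULift.{u} Bool ⊕ PUnit.{u + 1} :=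
    fun b => if b.down then .inr ⟨⟩ else .inl ⟨true⟩
  obtain ⟨h, hh, -⟩ := final _ (lowCoalg a fun b _ => b)
  obtain ⟨ψ, hψ, ψ_apply⟩ := hh.exists_inr (σ := .unit) (τ := .unit) (x := ⟨true⟩) rfl
  obtain ⟨χ, hχ, χ_apply⟩ := hh.exists_inr (σ := .unit) (τ := .unit) (x := ⟨false⟩) rfl
  have same_image := congrFun (congrFun ((final _ _).unique
    (isHOCoalgHom_lowHom_of_inr t _ ψ hψ) (isHOCoalgHom_lowHom_of_inr t _ χ hχ))
    (.arrow .unit .unit)) PUnit.unit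
  have same_fun : ψ = χ :=
    Sum.inr.inj (hψ.symm.trans ((congrArg (t (.arrow .unit .unit)) same_image).trans hχ))
  have collapse : h .unit ⟨true⟩ = h .unit ⟨false⟩ :=
    (ψ_apply ⟨true⟩).symm.trans ((congrFun same_fun _).trans (χ_apply ⟨true⟩))
  have h_true := hh .unit ⟨true⟩
  have h_false := hh .unit ⟨false⟩
  rw [collapse] at h_true
  exact Sum.inr_ne_inl (h_true.trans h_false.symm)
end

section
/- The M-category Set^Ty is stable: for every parallel pair f, g : A → B in Set^Ty and every jointly monic family (h_i : B → C_i)_{i∈I}, one has d(f,g) = sup_{i∈I} d(h_i ∘ f, h_i ∘ g). -/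
universe w u

/-- The complexity of a type: `|unit| = 1`, `|τ₁→τ₂| = |τ₁| + |τ₂|`. -/
def complexity : Ty → ℕ
  | .unit => 1
  | .arrow τ₁ τ₂ => complexity τ₁ + complexity τ₂

/-- The metric on hom-sets of `Set^Ty`:
`d(f,g) = sup{ 2^{-(|τ|-1)} : τ ∈ Ty, f_τ ≠ g_τ }` (with `sup ∅ = 0`). -/
noncomputable def tyDist {A B : TySet.{u}} (f g : TyHom A B) : ℝ :=
  sSup {x : ℝ | ∃ τ : Ty, f τ ≠ g τ ∧ x = (2 : ℝ) ^ (-((complexity τ : ℤ) - 1))}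

lemma one_le_complexity (τ : Ty) : 1 ≤ complexity τ := by
  induction τ with
  | unit => exact le_rfl
  | arrow τ₁ τ₂ h₁ _ => exact h₁.trans (Nat.le_add_right _ _)

lemma two_zpow_complexity_le_one (τ : Ty) :
    (2 : ℝ) ^ (-((complexity τ : ℤ) - 1)) ≤ 1 := by
  have := one_le_complexity τ
  exact zpow_le_one_of_nonpos₀ one_le_two (by lia)

lemma le_tyDist {A B : TySet.{u}} {f g : TyHom A B} {τ : Ty} (hτ : f τ ≠ g τ) :
    (2 : ℝ) ^ (-((complexity τ : ℤ) - 1)) ≤ tyDist f g := by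
  refine le_csSup ⟨1, ?_⟩ ⟨τ, hτ, rfl⟩
  rintro _ ⟨σ, -, rfl⟩
  exact two_zpow_complexity_le_one σ

lemma tyDist_le {A B : TySet.{u}} {f g : TyHom A B} {c : ℝ} (hc : 0 ≤ c)
    (h : ∀ τ, f τ ≠ g τ → (2 : ℝ) ^ (-((complexity τ : ℤ) - 1)) ≤ c) : tyDist f g ≤ c := by
  refine Real.sSup_le ?_ hc
  rintro _ ⟨τ, hτ, rfl⟩
  exact h τ hτ

lemma tyDist_nonneg {A B : TySet.{u}} (f g : TyHom A B) : 0 ≤ tyDist f g := by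
  refine Real.sSup_nonneg ?_
  rintro _ ⟨τ, -, rfl⟩
  positivity

lemma tyDist_comp_le {A B C : TySet.{u}} (f g : TyHom A B) (h : TyHom B C) :
    tyDist (tyComp f h) (tyComp g h) ≤ tyDist f g :=
  tyDist_le (tyDist_nonneg f g) fun τ hτ => le_tyDist fun hfg => hτ <| by
    funext x
    simp only [tyComp, hfg]

/-- A jointly monic family is jointly monic at every sort. -/
lemma eq_at_of_jointly_monic {A B : TySet.{u}} {f g : TyHom A B} {I : Type w}
    {C : I → TySet.{u}} {h : ∀ i : I, TyHom B (C i)}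
    (hmono : ∀ (A' : TySet.{u}) (p q : TyHom A' B),
      (∀ i : I, tyComp p (h i) = tyComp q (h i)) → p = q)
    {τ : Ty} (hτ : ∀ i, tyComp f (h i) τ = tyComp g (h i) τ) : f τ = g τ := by
  have key := hmono (fun σ => {_a : A σ // σ = τ}) (fun σ a => f σ a.1) (fun σ a => g σ a.1) <| by
    intro i
    funext σ ⟨a, hσ⟩
    subst hσ
    exact congrFun (hτ i) a
  funext a
  exact congrFun (congrFun key τ) ⟨a, rfl⟩

/-- The M-category `Set^Ty` is stable: for every parallel pair
`f, g : A → B` and every jointly monic family `(h_i : B → C_i)_{i∈I}` (with `I`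
inhabited), `d(f,g) = sup_{i∈I} d(h_i ∘ f, h_i ∘ g)`. -/
theorem setTy_stable {A B : TySet.{u}} (f g : TyHom A B)
    {I : Type w} [Nonempty I] (Cob : I → TySet.{u}) (h : ∀ i : I, TyHom B (Cob i))
    (hmono : ∀ (A' : TySet.{u}) (p q : TyHom A' B),
      (∀ i : I, tyComp p (h i) = tyComp q (h i)) → p = q) :
    tyDist f g = sSup {x : ℝ | ∃ i : I, x = tyDist (tyComp f (h i)) (tyComp g (h i))} := by
  have hbdd : BddAbove {x : ℝ | ∃ i : I, x = tyDist (tyComp f (h i)) (tyComp g (h i))} := by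
    refine ⟨tyDist f g, ?_⟩
    rintro _ ⟨i, rfl⟩
    exact tyDist_comp_le f g (h i)
  refine le_antisymm (tyDist_le (Real.sSup_nonneg ?_) fun τ hτ => ?_)
    (Real.sSup_le ?_ (tyDist_nonneg f g))
  · rintro _ ⟨i, rfl⟩
    exact tyDist_nonneg _ _
  · obtain ⟨i, hi⟩ : ∃ i, tyComp f (h i) τ ≠ tyComp g (h i) τ := by
      by_contra! hall
      exact hτ (eq_at_of_jointly_monic hmono hall)
    exact (le_tyDist hi).trans (le_csSup hbdd ⟨i, rfl⟩)
  · rintro _ ⟨i, rfl⟩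
    exact tyDist_comp_le f g (h i)
end

section
/- The xTCL behaviour bifunctor B on Set^Ty has a locally final coalgebra, and any two locally final coalgebras for B are isomorphic as higher-order B-coalgebras. -/
universe u

/-- A locally final coalgebra for `B`: a higher-order `B`-coalgebra `z : Z → B(Z,Z)`
that is a final coalgebra for the endofunctor `B(Z,−)`. -/
def IsLocallyFinalTy (Z : TySet.{u}) (z : TyHom Z (BObj Z Z)) : Prop :=
  ∀ (A : TySet.{u}) (c : TyHom A (BObj Z A)),
    ∃! h : TyHom A Z, ∀ (τ : Ty) (a : A τ), z τ (h τ a) = BMap (tyId Z) h τ (c τ a)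

/-- A coalgebra for the endofunctor `K + (-)` of `Type u` is final. -/
def IsFinalSumCoalg {K X : Type u} (c : X → K ⊕ X) : Prop :=
  ∀ (A : Type u) (a : A → K ⊕ A), ∃! h : A → X, ∀ x, c (h x) = Sum.map id h (a x)

theorem isFinalSumCoalg_destruct (K : Type u) :
    IsFinalSumCoalg (Computation.destruct : Computation K → K ⊕ Computation K) := by
  intro A a
  refine ⟨Computation.corec a, fun x => ?_, fun h hh => ?_⟩
  · rw [Computation.corec_eq]
    cases a x <;> rfl
  · funext x
    refine Computation.eq_of_bisim (fun s t => ∃ x, s = h x ∧ t = Computation.corec a x) ?_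
      ⟨x, rfl, rfl⟩
    rintro _ _ ⟨x, rfl, rfl⟩
    rw [hh, Computation.corec_eq]
    cases a x with
    | inl k => simp [Computation.BisimO, Computation.rmap]
    | inr y => exact ⟨y, rfl, rfl⟩

/-- An isomorphism of functors `K + (-) ≅ L + (-)` induces an isomorphism of final coalgebras. -/
theorem IsFinalSumCoalg.exists_equiv {K L X Y : Type u} {c : X → K ⊕ X} {d : Y → L ⊕ Y}
    (hc : IsFinalSumCoalg c) (hd : IsFinalSumCoalg d) (e : K ≃ L) :
    ∃ f : X ≃ Y, ∀ x, d (f x) = Sum.map e f (c x) := by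
  obtain ⟨f, hf, -⟩ := hd X (fun x => Sum.map e id (c x))
  obtain ⟨g, hg, -⟩ := hc Y (fun y => Sum.map e.symm id (d y))
  have hgf : g ∘ f = id := (hc X c).unique
    (fun x => by simp [hf, hg, ← Function.id_def, Function.comp_def]) (fun x => by simp)
  have hfg : f ∘ g = id := (hd Y d).unique
    (fun x => by simp [hf, hg, ← Function.id_def, Function.comp_def]) (fun x => by simp)
  exact ⟨⟨f, g, congrFun hgf, congrFun hfg⟩, fun x => by simp [hf]⟩

/-- The summand of `BObj X Y τ` consisting of terminated behaviours. -/
def BVal (X Y : TySet.{u}) : TySet.{u}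
  | .unit => PUnit
  | .arrow τ₁ τ₂ => X τ₁ → Y τ₂

/-- The functorial action of `BVal`. -/
def BVal.map {X X' Y Y' : TySet.{u}} (f : TyHom X' X) (g : TyHom Y Y') :
    TyHom (BVal X Y) (BVal X' Y')
  | .unit => fun u => u
  | .arrow τ₁ τ₂ => fun φ x => g τ₂ (φ (f τ₁ x))

/-- `BObj X Y τ` is the sum of `BVal X Y τ` and `Y τ`. -/
def BObj.split {X Y : TySet.{u}} : ∀ τ, BObj X Y τ ≃ BVal X Y τ ⊕ Y τ
  | .unit => Equiv.sumComm _ _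
  | .arrow _ _ => Equiv.sumComm _ _

theorem BObj.split_map {X X' Y Y' : TySet.{u}} (f : TyHom X' X) (g : TyHom Y Y') (τ : Ty)
    (b : BObj X Y τ) :
    BObj.split τ (BMap f g τ b) = Sum.map (BVal.map f g τ) (g τ) (BObj.split τ b) := by
  cases τ <;> cases b <;> rfl

theorem eq_map_iff_split {X X' Y Y' : TySet.{u}} (f : TyHom X' X) (g : TyHom Y Y') (τ : Ty)
    (b : BObj X Y τ) (b' : BObj X' Y' τ) :
    b' = BMap f g τ b ↔
      BObj.split τ b' = Sum.map (BVal.map f g τ) (g τ) (BObj.split τ b) := by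
  rw [← BObj.split_map, (BObj.split τ).apply_eq_iff_eq]

theorem BVal.map_id {X Y : TySet.{u}} (τ : Ty) : BVal.map (tyId X) (tyId Y) τ = id := by
  cases τ <;> rfl

theorem BVal.map_map {X X' X'' Y Y' Y'' : TySet.{u}} (f : TyHom X' X) (g : TyHom Y Y')
    (f' : TyHom X'' X') (g' : TyHom Y' Y'') (τ : Ty) (v : BVal X Y τ) :
    BVal.map f' g' τ (BVal.map f g τ v) = BVal.map (tyComp f' f) (tyComp g g') τ v := by
  cases τ <;> rfl

section SortwiseFinality

variable {Z : TySet.{u}} {z : TyHom Z (BObj Z Z)}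

/-- The coinductive extension of a `B(Z,-)`-coalgebra, built by recursion on the sort. -/
noncomputable def sortwiseLift (H : ∀ τ, IsFinalSumCoalg fun x => BObj.split τ (z τ x))
    {A : TySet.{u}} (c : TyHom A (BObj Z A)) : TyHom A Z
  | .unit => (H .unit (A .unit) fun x => BObj.split .unit (c .unit x)).choose
  | .arrow τ₁ τ₂ => (H (.arrow τ₁ τ₂) (A (.arrow τ₁ τ₂)) fun x =>
      Sum.map (fun (φ : Z τ₁ → A τ₂) y => sortwiseLift H c τ₂ (φ y)) id
        (BObj.split (.arrow τ₁ τ₂) (c (.arrow τ₁ τ₂) x))).choose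

theorem isLocallyFinalTy_of_sortwise (H : ∀ τ, IsFinalSumCoalg fun x => BObj.split τ (z τ x)) :
    IsLocallyFinalTy Z z := by
  intro A c
  simp only [eq_map_iff_split]
  refine ⟨sortwiseLift H c, fun τ a => ?_, fun h hh => ?_⟩
  · cases τ with
    | unit =>
      rw [sortwiseLift]
      exact (H .unit (A .unit) fun x => BObj.split .unit (c .unit x)).choose_spec.1 a
    | arrow τ₁ τ₂ =>
      have := (H (.arrow τ₁ τ₂) (A (.arrow τ₁ τ₂)) fun x =>
        Sum.map (fun (φ : Z τ₁ → A τ₂) y => sortwiseLift H c τ₂ (φ y)) id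
          (BObj.split (.arrow τ₁ τ₂) (c (.arrow τ₁ τ₂) x))).choose_spec.1 a
      rw [sortwiseLift]
      exact this.trans (Sum.map_map ..)
  · funext τ
    induction τ with
    | unit =>
      rw [sortwiseLift]
      exact (H .unit (A .unit) fun x => BObj.split .unit (c .unit x)).choose_spec.2 _ (hh .unit)
    | arrow τ₁ τ₂ _ ih =>
      rw [sortwiseLift]
      refine (H (.arrow τ₁ τ₂) (A (.arrow τ₁ τ₂)) fun x =>
        Sum.map (fun (φ : Z τ₁ → A τ₂) y => sortwiseLift H c τ₂ (φ y)) id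
          (BObj.split (.arrow τ₁ τ₂) (c (.arrow τ₁ τ₂) x))).choose_spec.2 _ fun a => ?_
      rw [← ih]
      refine Eq.trans ?_ (Sum.map_map (α' := Z τ₁ → Z τ₂) id _ _ id _).symm
      exact hh (.arrow τ₁ τ₂) a

/-- The `Ty`-sorted set with a single nonempty sort. -/
inductive SingleSort (τ : Ty) (Y : Type u) : TySet.{u}
  | mk (y : Y) : SingleSort τ Y τ

/-- The extension of a map on one sort to a `Ty`-sorted function. -/
def SingleSort.lift {τ : Ty} {Y : Type u} {X : TySet.{u}} (h : Y → X τ) :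
    TyHom (SingleSort τ Y) X
  | _, .mk y => h y

/-- The inclusion of `Z` into its extension by one new sort component. -/
def inclRight (P : TySet.{u}) (Z : TySet.{u}) : TyHom Z (fun σ => P σ ⊕ Z σ) :=
  fun _ => Sum.inr

/-- The extension of the coalgebra `z` by a coalgebra `a` living on the sort `τ`. -/
def extendCoalg (z : TyHom Z (BObj Z Z)) {τ : Ty} {Y : Type u} (a : Y → BVal Z Z τ ⊕ Y) :
    TyHom (fun σ => SingleSort τ Y σ ⊕ Z σ) (BObj Z fun σ => SingleSort τ Y σ ⊕ Z σ)
  | _, .inl (.mk y) => (BObj.split τ).symm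
      (Sum.map (BVal.map (tyId Z) (inclRight _ Z) τ) (fun y => .inl (.mk y)) (a y))
  | σ, .inr x => BMap (tyId Z) (inclRight _ Z) σ (z σ x)

theorem IsLocallyFinalTy.sortwise (hz : IsLocallyFinalTy Z z) (τ : Ty) :
    IsFinalSumCoalg fun x => BObj.split τ (z τ x) := by
  intro Y a
  have key := hz _ (extendCoalg z a)
  simp only [eq_map_iff_split] at key
  apply existsUnique_of_exists_of_unique
  · obtain ⟨h, hh, -⟩ := key
    have hid : tyComp (inclRight _ Z) h = tyId Z := by
      refine (hz Z z).unique (fun σ x => ?_) (fun σ x => ?_)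
      · rw [eq_map_iff_split]
        refine (hh σ (.inr x)).trans ?_
        simp only [extendCoalg]
        rw [BObj.split_map, Sum.map_map]
        congr 1
        funext v
        exact BVal.map_map ..
      · rw [eq_map_iff_split, BVal.map_id]
        exact Sum.map_id_id.symm ▸ rfl
    refine ⟨fun y => h τ (.inl (.mk y)), fun y => ?_⟩
    refine (hh τ (.inl (.mk y))).trans ?_
    simp only [extendCoalg, Equiv.apply_symm_apply]
    rw [Sum.map_map]
    congr 1
    funext v
    refine (BVal.map_map ..).trans ?_
    rw [hid]
    exact congrFun (BVal.map_id τ) v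
  · intro h₁ h₂ hh₁ hh₂
    have aux : ∀ h : Y → Z τ, (∀ y, BObj.split τ (z τ (h y)) = Sum.map id h (a y)) →
        ∀ σ (x : SingleSort τ Y σ ⊕ Z σ),
          BObj.split σ (z σ (Sum.elim (SingleSort.lift h σ) id x)) =
            Sum.map (BVal.map (tyId Z) (fun σ => Sum.elim (SingleSort.lift h σ) id) σ)
              (Sum.elim (SingleSort.lift h σ) id) (BObj.split σ (extendCoalg z a σ x)) := by
      rintro h hh σ (⟨⟨y⟩⟩ | x)
      · simp only [extendCoalg, Equiv.apply_symm_apply]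
        refine (hh y).trans ?_
        rw [Sum.map_map]
        congr 1
        funext v
        refine Eq.trans ?_ (BVal.map_map (tyId Z) (inclRight _ Z) (tyId Z) _ τ v).symm
        exact (congrFun (BVal.map_id τ) v).symm
      · simp only [extendCoalg]
        rw [BObj.split_map, Sum.map_map]
        have : BVal.map (tyId Z) (fun σ => Sum.elim (SingleSort.lift h σ) id) σ ∘
            BVal.map (tyId Z) (inclRight _ Z) σ = id := by
          funext v
          exact (BVal.map_map ..).trans (congrFun (BVal.map_id σ) v)
        rw [this]
        exact (congrFun Sum.map_id_id _).symm
    have := key.unique (aux h₁ hh₁) (aux h₂ hh₂)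
    funext y
    exact congrFun (congrFun this τ) (.inl (.mk y))

end SortwiseFinality

/-- The carrier of the locally final coalgebra: delayed values. -/
def delayCarrier : TySet.{u}
  | .unit => Computation PUnit
  | .arrow τ₁ τ₂ => Computation (delayCarrier τ₁ → delayCarrier τ₂)

/-- The structure of the locally final coalgebra: perform one step. -/
def delayStep : TyHom delayCarrier.{u} (BObj delayCarrier delayCarrier)
  | .unit => fun x => (BObj.split .unit).symm
      (Computation.destruct (show Computation PUnit from x))
  | .arrow τ₁ τ₂ => fun x => (BObj.split (.arrow τ₁ τ₂)).symm
      (Computation.destruct (show Computation (delayCarrier τ₁ → delayCarrier τ₂) from x))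

theorem isLocallyFinalTy_delayStep : IsLocallyFinalTy delayCarrier.{u} delayStep := by
  refine isLocallyFinalTy_of_sortwise fun τ => ?_
  cases τ with
  | unit =>
    rw [show (fun x => BObj.split .unit (delayStep .unit x)) = Computation.destruct from
      funext fun x => (BObj.split .unit).apply_symm_apply _]
    exact isFinalSumCoalg_destruct _
  | arrow τ₁ τ₂ =>
    rw [show (fun x => BObj.split (.arrow τ₁ τ₂) (delayStep (.arrow τ₁ τ₂) x)) =
      Computation.destruct from funext fun x => (BObj.split (.arrow τ₁ τ₂)).apply_symm_apply _]
    exact isFinalSumCoalg_destruct _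

section Uniqueness

variable {Z W : TySet.{u}} {z : TyHom Z (BObj Z Z)} {w : TyHom W (BObj W W)}

/-- The isomorphism of values induced by a sortwise isomorphism. -/
def BVal.congr (e : ∀ τ, Z τ ≃ W τ) (τ : Ty) : BVal Z Z τ ≃ BVal W W τ where
  toFun := BVal.map (fun σ => (e σ).symm) (fun σ => e σ) τ
  invFun := BVal.map (fun σ => e σ) (fun σ => (e σ).symm) τ
  left_inv v := by
    refine (BVal.map_map ..).trans ?_
    cases τ <;> simp [BVal.map, tyComp]
    rfl
  right_inv v := by
    refine (BVal.map_map ..).trans ?_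
    cases τ <;> simp [BVal.map, tyComp]
    rfl

theorem exists_sortwise_equiv (hz : IsLocallyFinalTy Z z) (hw : IsLocallyFinalTy W w) :
    ∃ e : ∀ τ, Z τ ≃ W τ, ∀ τ x, BObj.split τ (w τ (e τ x)) =
      Sum.map (BVal.map (fun σ => (e σ).symm) (fun σ => e σ) τ) (e τ)
        (BObj.split τ (z τ x)) := by
  choose F hF using fun τ => (hz.sortwise τ).exists_equiv (hw.sortwise τ)
  let e : ∀ τ, Z τ ≃ W τ := fun τ => Ty.rec (motive := fun τ => Z τ ≃ W τ)
    (F .unit (Equiv.refl PUnit))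
    (fun τ₁ τ₂ e₁ e₂ => F (.arrow τ₁ τ₂) (e₁.arrowCongr e₂)) τ
  refine ⟨e, fun τ x => ?_⟩
  cases τ
  · exact hF .unit _ x
  · exact hF (.arrow _ _) _ x

theorem isHOCoalgHom_of_equiv (e : ∀ τ, Z τ ≃ W τ)
    (he : ∀ τ x, BObj.split τ (w τ (e τ x)) =
      Sum.map (BVal.map (fun σ => (e σ).symm) (fun σ => e σ) τ) (e τ) (BObj.split τ (z τ x))) :
    IsHOCoalgHom z w (fun τ => e τ) := by
  intro τ x
  rw [eq_map_iff_split, BObj.split_map, he, Sum.map_map]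
  congr 1
  funext v
  refine Eq.trans ?_ (BVal.map_map ..).symm
  congr 1
  funext σ y
  exact ((e σ).symm_apply_apply y).symm

end Uniqueness

/-- The xTCL behaviour bifunctor `B` on `Set^Ty` has a locally final
coalgebra, and any two locally final coalgebras for `B` are isomorphic as higher-order
`B`-coalgebras. -/
theorem xTCL_locally_final_exists_unique :
    (∃ (Z : TySet.{u}) (z : TyHom Z (BObj Z Z)), IsLocallyFinalTy Z z) ∧
    (∀ (Z : TySet.{u}) (z : TyHom Z (BObj Z Z)) (W : TySet.{u}) (w : TyHom W (BObj W W)),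
      IsLocallyFinalTy Z z → IsLocallyFinalTy W w →
      ∃ (h : TyHom Z W) (k : TyHom W Z),
        tyComp h k = tyId Z ∧ tyComp k h = tyId W ∧
        IsHOCoalgHom z w h ∧ IsHOCoalgHom w z k) := by
  refine ⟨⟨delayCarrier, delayStep, isLocallyFinalTy_delayStep⟩, fun Z z W w hz hw => ?_⟩
  obtain ⟨e, he⟩ := exists_sortwise_equiv hz hw
  refine ⟨fun τ => e τ, fun τ => (e τ).symm, ?_, ?_, isHOCoalgHom_of_equiv e he,
    isHOCoalgHom_of_equiv (fun τ => (e τ).symm) fun τ y => ?_⟩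
  · funext τ x
    exact (e τ).symm_apply_apply x
  · funext τ y
    exact (e τ).apply_symm_apply y
  · obtain ⟨x, rfl⟩ := (e τ).surjective y
    rw [Equiv.symm_apply_apply, he, Sum.map_map]
    have : BVal.map (fun σ => (e σ).symm.symm) (fun σ => (e σ).symm) τ ∘
        BVal.map (fun σ => (e σ).symm) (fun σ => e σ) τ = id :=
      funext (BVal.congr e τ).symm_apply_apply
    rw [this, Equiv.symm_comp_self, Sum.map_id_id, id]
end

section
/- The Ty-sorted set Z defined by structural recursion on types, together with the copairing z of the coalgebra structures z_τ, is a locally final coalgebra z : Z → B(Z,Z) for the xTCL behaviour bifunctor B. -/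
universe u

theorem BMap_tyId_unit {Z A B : TySet.{u}} (h : TyHom A B) (s : A .unit ⊕ PUnit) :
    BMap (tyId Z) h .unit s = Sum.map (h .unit) id s := by
  cases s <;> rfl

theorem BMap_tyId_arrow {Z A B : TySet.{u}} (h : TyHom A B) (τ₁ τ₂ : Ty)
    (s : A (.arrow τ₁ τ₂) ⊕ (Z τ₁ → A τ₂)) :
    BMap (tyId Z) h (.arrow τ₁ τ₂) s =
      Sum.map (h (.arrow τ₁ τ₂)) id (Sum.map id (fun φ x => h τ₂ (φ x)) s) := by
  cases s <;> rfl

/-- Let `Z` be the `Ty`-sorted set defined by structural recursion on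
types: `(Z_unit, z_unit)` is a final coalgebra for `Y ↦ Y + 1` and
`(Z_{τ₁→τ₂}, z_{τ₁→τ₂})` is a final coalgebra for `Y ↦ Y + Z_{τ₂}^{Z_{τ₁}}`.
Then `(Z, z)`, with `z` the copairing of the structures `z_τ`, is a locally final
coalgebra for the xTCL behaviour bifunctor `B`. -/
theorem recursive_Z_is_locally_final
    (Z : TySet.{u}) (z : TyHom Z (BObj Z Z))
    (hunit : ∀ (A : Type u) (c : A → A ⊕ PUnit),
      ∃! h : A → Z .unit, ∀ a : A, z .unit (h a) = Sum.map h id (c a))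
    (harrow : ∀ (τ₁ τ₂ : Ty) (A : Type u) (c : A → A ⊕ (Z τ₁ → Z τ₂)),
      ∃! h : A → Z (.arrow τ₁ τ₂),
        ∀ a : A, z (.arrow τ₁ τ₂) (h a) = Sum.map h id (c a)) :
    IsLocallyFinalTy Z z := by
  intro A c
  choose f hf hf_unique using fun τ₁ τ₂ (g : A τ₂ → Z τ₂) =>
    harrow τ₁ τ₂ (A (.arrow τ₁ τ₂))
      (fun a => Sum.map id (fun φ x => g (φ x)) (c (.arrow τ₁ τ₂) a))
  obtain ⟨k, hk, hk_unique⟩ := hunit (A .unit) (c .unit)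
  let h : TyHom A Z := fun τ => Ty.rec (motive := fun τ => A τ → Z τ) k
    (fun τ₁ τ₂ _ g => f τ₁ τ₂ g) τ
  refine ⟨h, ?_, ?_⟩
  · rintro (_ | ⟨τ₁, τ₂⟩) a
    · exact (hk a).trans (BMap_tyId_unit h _).symm
    · exact (hf τ₁ τ₂ (h τ₂) a).trans (BMap_tyId_arrow h τ₁ τ₂ _).symm
  · intro h' hh'
    funext τ
    induction τ with
    | unit => exact hk_unique _ fun a => (hh' .unit a).trans (BMap_tyId_unit h' _)
    | arrow τ₁ τ₂ _ ih =>
      have key := hf_unique τ₁ τ₂ (h' τ₂) (h' (.arrow τ₁ τ₂)) fun a =>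
        (hh' (.arrow τ₁ τ₂) a).trans (BMap_tyId_arrow h' τ₁ τ₂ _)
      rw [key, ih]
end

section
/- Let F : (Set^Ty)^op → Set^Ty be the functor sending X to the carrier of the final coalgebra of the endofunctor B(X,−), let 1 be the terminal object of Set^Ty, and let Z be the Ty-sorted set defined by structural recursion on types as above. Then for every type τ ∈ Ty and every natural number n ≥ |τ|, the component (F^n 1)_τ is (canonically isomorphic to) Z_τ. -/
universe u

/-- A coalgebra `t : T → T ⊕ E` is final for the set functor `Y ↦ Y + E`. -/
def IsFinalSum {T E : Type u} (t : T → T ⊕ E) : Prop :=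
  ∀ (A : Type u) (c : A → A ⊕ E), ∃! h : A → T, ∀ a, t (h a) = Sum.map h id (c a)

theorem IsFinalSum.nonempty_equiv {T T' E : Type u} {t : T → T ⊕ E} {t' : T' → T' ⊕ E}
    (ht : IsFinalSum t) (ht' : IsFinalSum t') : Nonempty (T ≃ T') := by
  obtain ⟨f, hf, -⟩ := ht' T t
  obtain ⟨g, hg, -⟩ := ht T' t'
  refine ⟨⟨f, g, fun x => ?_, fun x => ?_⟩⟩
  · exact congrFun ((ht T t).unique (y₁ := g ∘ f) (y₂ := id)
      (fun a => by simp [hg, hf]) (fun a => by simp)) x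
  · exact congrFun ((ht' T' t').unique (y₁ := f ∘ g) (y₂ := id)
      (fun a => by simp [hg, hf]) (fun a => by simp)) x

theorem isFinalSum_destruct (E : Type u) :
    IsFinalSum fun s : Computation E => (Computation.destruct s).swap := by
  intro A c
  refine ⟨Computation.corec fun a => (c a).swap, fun a => ?_, fun h hh => funext fun a => ?_⟩
  · simp only [Computation.corec_eq]
    rcases c a with b | e <;> rfl
  · refine Computation.eq_of_bisim
      (fun s s' => ∃ a, s = h a ∧ s' = Computation.corec (fun a => (c a).swap) a) ?_ ⟨a, rfl, rfl⟩
    rintro _ _ ⟨a, rfl, rfl⟩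
    have ha : Computation.destruct (h a) = (Sum.map h id (c a)).swap := by simp [← hh a]
    rw [ha, Computation.corec_eq]
    rcases c a with b | e
    · exact ⟨b, rfl, rfl⟩
    · exact rfl

/-- An equivalence of return types induces one of computations. -/
def Computation.mapEquiv {E E' : Type u} (e : E ≃ E') : Computation E ≃ Computation E' where
  toFun := Computation.map e
  invFun := Computation.map e.symm
  left_inv s := by simp [← Computation.map_comp]
  right_inv s := by simp [← Computation.map_comp]

/-- An explicit model of the carrier of the final coalgebra of `B(X,−)`. -/
def finalModel (X : TySet.{u}) : TySet.{u}
  | .unit => Computation PUnit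
  | .arrow τ₁ τ₂ => Computation (X τ₁ → finalModel X τ₂)

/-- The coalgebra structure of `finalModel X`. -/
def finalModelCoalg (X : TySet.{u}) : TyHom (finalModel X) (BObj X (finalModel X))
  | .unit => fun s => (Computation.destruct s).swap
  | .arrow _ _ => fun s => (Computation.destruct s).swap

theorem existsUnique_finalModel (X A : TySet.{u}) (c : TyHom A (BObj X A)) :
    ∃! h : TyHom A (finalModel X), ∀ (τ : Ty) (a : A τ),
      finalModelCoalg X τ (h τ a) = BMap (tyId X) h τ (c τ a) := by
  obtain ⟨u, hu, hu'⟩ := isFinalSum_destruct PUnit (A .unit) (c .unit)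
  have harr (τ₁ τ₂ : Ty) (k : A τ₂ → finalModel X τ₂) :=
    isFinalSum_destruct (X τ₁ → finalModel X τ₂) (A (.arrow τ₁ τ₂))
      fun a => Sum.map id (fun φ x => k (φ x)) (c (.arrow τ₁ τ₂) a)
  choose v hv hv' using harr
  let h : TyHom A (finalModel X) := fun τ => Ty.rec (motive := fun τ => A τ → finalModel X τ)
    u (fun τ₁ τ₂ _ k => v τ₁ τ₂ k) τ
  refine ⟨h, ?_, ?_⟩
  · rintro (_ | ⟨τ₁, τ₂⟩) a
    · refine (hu a).trans ?_
      generalize c .unit a = y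
      rcases y with y | y <;> rfl
    · refine (hv τ₁ τ₂ (h τ₂) a).trans ?_
      generalize c (.arrow τ₁ τ₂) a = y
      rcases y with y | y <;> rfl
  · intro g hg
    funext τ
    induction τ with
    | unit =>
      refine hu' _ fun a => (hg .unit a).trans ?_
      generalize c .unit a = y
      rcases y with y | y <;> rfl
    | arrow τ₁ τ₂ _ ih =>
      refine hv' τ₁ τ₂ (h τ₂) _ fun a => (hg (.arrow τ₁ τ₂) a).trans ?_
      rw [← ih]
      generalize c (.arrow τ₁ τ₂) a = y
      rcases y with y | y <;> rfl

theorem BMap_tyComp {X A A' A'' : TySet.{u}} (f : TyHom A A') (g : TyHom A' A'') (τ : Ty)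
    (y : BObj X A τ) :
    BMap (tyId X) (tyComp f g) τ y = BMap (tyId X) g τ (BMap (tyId X) f τ y) := by
  rcases τ with _ | ⟨τ₁, τ₂⟩ <;> rcases y with y | y <;> rfl

theorem BMap_tyId {X A : TySet.{u}} (τ : Ty) (y : BObj X A τ) :
    BMap (tyId X) (tyId A) τ y = y := by
  rcases τ with _ | ⟨τ₁, τ₂⟩ <;> rcases y with y | y <;> rfl

/-- Two final `B(X,−)`-coalgebras have isomorphic carriers. -/
theorem nonempty_equiv_of_final {X T T' : TySet.{u}} (t : TyHom T (BObj X T))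
    (t' : TyHom T' (BObj X T'))
    (ht : ∀ (A : TySet.{u}) (c : TyHom A (BObj X A)), ∃! h : TyHom A T,
      ∀ (τ : Ty) (a : A τ), t τ (h τ a) = BMap (tyId X) h τ (c τ a))
    (ht' : ∀ (A : TySet.{u}) (c : TyHom A (BObj X A)), ∃! h : TyHom A T',
      ∀ (τ : Ty) (a : A τ), t' τ (h τ a) = BMap (tyId X) h τ (c τ a)) (τ : Ty) :
    Nonempty (T τ ≃ T' τ) := by
  obtain ⟨f, hf, -⟩ := ht' T t
  obtain ⟨g, hg, -⟩ := ht T' t'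
  refine ⟨⟨f τ, g τ, fun x => ?_, fun x => ?_⟩⟩
  · exact congrFun (congrFun ((ht T t).unique (y₁ := tyComp f g) (y₂ := tyId T)
      (fun σ a => by rw [BMap_tyComp, ← hf, ← hg]; rfl) (fun σ a => by rw [BMap_tyId]; rfl)) τ) x
  · exact congrFun (congrFun ((ht' T' t').unique (y₁ := tyComp g f) (y₂ := tyId T')
      (fun σ a => by rw [BMap_tyComp, ← hg, ← hf]; rfl) (fun σ a => by rw [BMap_tyId]; rfl)) τ) x

theorem complexity_pos (τ : Ty) : 0 < complexity τ := by
  induction τ with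
  | unit => exact Nat.one_pos
  | arrow τ₁ τ₂ ih _ => exact Nat.add_pos_left ih _

/-- Let `F : (Set^Ty)^op → Set^Ty` send `X` to the carrier of the
final coalgebra of `B(X,−)`, let `1` be the terminal object of `Set^Ty`, and let `Z`
be the `Ty`-sorted set defined by structural recursion on types. Then for every type
`τ` and every `n ≥ |τ|`, the component `(F^n 1)_τ` is canonically isomorphic to `Z_τ`. -/
theorem iterate_F_component_eq_Z
    -- Z defined by structural recursion on types
    (Z : TySet.{u}) (z : TyHom Z (BObj Z Z))
    (hunit : ∀ (A : Type u) (c : A → A ⊕ PUnit),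
      ∃! h : A → Z .unit, ∀ a : A, z .unit (h a) = Sum.map h id (c a))
    (harrow : ∀ (τ₁ τ₂ : Ty) (A : Type u) (c : A → A ⊕ (Z τ₁ → Z τ₂)),
      ∃! h : A → Z (.arrow τ₁ τ₂),
        ∀ a : A, z (.arrow τ₁ τ₂) (h a) = Sum.map h id (c a))
    -- F X = νB(X,−), the carrier of a final coalgebra of the endofunctor B(X,−)
    (F : TySet.{u} → TySet.{u})
    (coalg : ∀ X : TySet.{u}, TyHom (F X) (BObj X (F X)))
    (hfin : ∀ (X A : TySet.{u}) (c : TyHom A (BObj X A)),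
      ∃! h : TyHom A (F X), ∀ (τ : Ty) (a : A τ),
        coalg X τ (h τ a) = BMap (tyId X) h τ (c τ a)) :
    ∀ (τ : Ty) (n : ℕ), complexity τ ≤ n →
      Nonempty ((F^[n] (fun _ => PUnit)) τ ≃ Z τ) := by
  intro τ n hn
  induction n generalizing τ with
  | zero => exact absurd (complexity_pos τ) (by omega)
  | succ n ih =>
    rw [Function.iterate_succ_apply']
    set X := F^[n] (fun _ => PUnit)
    obtain ⟨e⟩ := nonempty_equiv_of_final (coalg X) (finalModelCoalg X) (hfin X)
      (existsUnique_finalModel X) τ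
    suffices Nonempty (finalModel X τ ≃ Z τ) from this.map e.trans
    clear e
    induction τ with
    | unit => exact (isFinalSum_destruct PUnit).nonempty_equiv (t' := z .unit) hunit
    | arrow τ₁ τ₂ _ ih₂ =>
      have h₁ := complexity_pos τ₁
      have h₂ := complexity_pos τ₂
      simp only [complexity] at hn
      obtain ⟨e₁⟩ := ih τ₁ (by omega)
      obtain ⟨e₂⟩ := ih₂ (by omega)
      obtain ⟨e⟩ := (isFinalSum_destruct (Z τ₁ → Z τ₂)).nonempty_equiv
        (t' := z (.arrow τ₁ τ₂)) (harrow τ₁ τ₂)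
      exact ⟨(Computation.mapEquiv (e₁.arrowCongr e₂)).trans e⟩
end

section
/- The topos of trees Set^{ω^op} is a stable M-category with respect to the metric d(μ,ν) = sup{2^{-n} : n ∈ ω, μ_n ≠ ν_n} on its hom-sets: each hom-set is a complete, 1-bounded ultrametric space, composition is non-expansive, and for every parallel pair f, g and every jointly monic family (h_i)_{i∈I} one has d(f,g) = sup_{i∈I} d(h_i ∘ f, h_i ∘ g). -/
universe w u

/-- An object of the topos of trees `Set^{ω^op}`: a family of sets `(X_n)` with
restriction maps `X_{n+1} → X_n` (generating all restrictions `X_n → X_m`, `n ≥ m`). -/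
structure OmTree : Type (u + 1) where
  obj : ℕ → Type u
  res : ∀ n : ℕ, obj (n + 1) → obj n

/-- A morphism of `Set^{ω^op}`: a natural transformation. -/
@[ext]
structure OmTreeHom (X Y : OmTree.{u}) where
  app : ∀ n : ℕ, X.obj n → Y.obj n
  natural : ∀ (n : ℕ) (x : X.obj (n + 1)), Y.res n (app (n + 1) x) = app n (X.res n x)

/-- The identity morphism. -/
def OmTreeHom.id (X : OmTree.{u}) : OmTreeHom X X :=
  ⟨fun _ x => x, fun _ _ => rfl⟩

/-- Composition (diagrammatic order). -/
def OmTreeHom.comp {X Y Z : OmTree.{u}} (f : OmTreeHom X Y) (g : OmTreeHom Y Z) : OmTreeHom X Z where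
  app n x := g.app n (f.app n x)
  natural n x := by rw [g.natural, f.natural]


/-- The metric on hom-sets of the topos of trees:
`d(μ,ν) = sup{ 2^{-n} : n ∈ ω, μ_n ≠ ν_n }` (with `sup ∅ = 0`). -/
noncomputable def treeDist {X Y : OmTree.{u}} (μ ν : OmTreeHom X Y) : ℝ :=
  sSup {x : ℝ | ∃ n : ℕ, μ.app n ≠ ν.app n ∧ x = (2 : ℝ) ^ (-(n : ℤ))}

section

variable {X Y : OmTree.{u}}

theorem zpow_neg_le_treeDist {μ ν : OmTreeHom X Y} {n : ℕ} (h : μ.app n ≠ ν.app n) :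
    (2 : ℝ) ^ (-(n : ℤ)) ≤ treeDist μ ν := by
  refine le_csSup ⟨1, ?_⟩ ⟨n, h, rfl⟩
  rintro x ⟨m, -, rfl⟩
  exact zpow_le_one_of_nonpos₀ one_le_two (by simp)

theorem treeDist_nonneg (μ ν : OmTreeHom X Y) : 0 ≤ treeDist μ ν := by
  refine Real.sSup_nonneg ?_
  rintro x ⟨n, -, rfl⟩
  positivity

theorem treeDist_le {μ ν : OmTreeHom X Y} {c : ℝ} (hc : 0 ≤ c)
    (h : ∀ n : ℕ, μ.app n ≠ ν.app n → (2 : ℝ) ^ (-(n : ℤ)) ≤ c) : treeDist μ ν ≤ c := by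
  refine Real.sSup_le ?_ hc
  rintro x ⟨n, hn, rfl⟩
  exact h n hn

theorem app_eq_of_treeDist_lt {μ ν : OmTreeHom X Y} {n : ℕ}
    (h : treeDist μ ν < (2 : ℝ) ^ (-(n : ℤ))) : μ.app n = ν.app n := by
  by_contra hn
  exact absurd (zpow_neg_le_treeDist hn) h.not_ge

theorem treeDist_le_one (μ ν : OmTreeHom X Y) : treeDist μ ν ≤ 1 :=
  treeDist_le zero_le_one fun _ _ => zpow_le_one_of_nonpos₀ one_le_two (by simp)

theorem treeDist_self (μ : OmTreeHom X Y) : treeDist μ μ = 0 :=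
  le_antisymm (treeDist_le le_rfl fun _ hn => absurd rfl hn) (treeDist_nonneg μ μ)

theorem treeDist_comm (μ ν : OmTreeHom X Y) : treeDist μ ν = treeDist ν μ := by
  simp only [treeDist, ne_comm]

theorem eq_of_treeDist_eq_zero {μ ν : OmTreeHom X Y} (h : treeDist μ ν = 0) : μ = ν := by
  refine OmTreeHom.ext (funext fun n => app_eq_of_treeDist_lt ?_)
  rw [h]
  positivity

theorem treeDist_le_max (f g h : OmTreeHom X Y) :
    treeDist f h ≤ max (treeDist f g) (treeDist g h) := by
  refine treeDist_le (le_max_of_le_left (treeDist_nonneg f g)) fun n hn => ?_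
  by_cases hfg : f.app n = g.app n
  · exact le_max_of_le_right (zpow_neg_le_treeDist (hfg ▸ hn))
  · exact le_max_of_le_left (zpow_neg_le_treeDist hfg)

theorem treeDist_comp_le {Z : OmTree.{u}} (f g : OmTreeHom X Y) (f' g' : OmTreeHom Y Z) :
    treeDist (f.comp f') (g.comp g') ≤ max (treeDist f g) (treeDist f' g') := by
  refine treeDist_le (le_max_of_le_left (treeDist_nonneg f g)) fun n hn => ?_
  by_cases hfg : f.app n = g.app n
  · refine le_max_of_le_right (zpow_neg_le_treeDist fun h => hn ?_)
    simp only [OmTreeHom.comp, hfg, h]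
  · exact le_max_of_le_left (zpow_neg_le_treeDist hfg)

theorem exists_treeDist_limit (μ : ℕ → OmTreeHom X Y)
    (hμ : ∀ ε : ℝ, 0 < ε →
      ∃ N : ℕ, ∀ m n : ℕ, N ≤ m → N ≤ n → treeDist (μ m) (μ n) < ε) :
    ∃ f : OmTreeHom X Y, ∀ ε : ℝ, 0 < ε →
      ∃ N : ℕ, ∀ n : ℕ, N ≤ n → treeDist (μ n) f < ε := by
  choose N hN using fun n : ℕ => hμ ((2 : ℝ) ^ (-(n : ℤ))) (by positivity)
  have app_eq (n k : ℕ) (hk : N n ≤ k) : (μ k).app n = (μ (N n)).app n :=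
    app_eq_of_treeDist_lt (hN n k (N n) hk le_rfl)
  refine ⟨⟨fun n => (μ (N n)).app n, fun n x => ?_⟩, fun ε hε => ?_⟩
  · rw [← app_eq n _ (le_max_left _ (N (n + 1))), ← app_eq (n + 1) _ (le_max_right (N n) _)]
    exact (μ _).natural n x
  · obtain ⟨M, hM⟩ := hμ (ε / 2) (half_pos hε)
    refine ⟨M, fun n hn => (treeDist_le (half_pos hε).le fun k hk => ?_).trans_lt (half_lt_self hε)⟩
    rw [← app_eq k _ (le_max_right M _)] at hk
    exact (zpow_neg_le_treeDist hk).trans (hM n _ hn (le_max_left _ _)).le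

/-- The joint kernel pair of a family of morphisms out of `Y`. -/
def jointKernelPair {I : Type w} {C : I → OmTree.{u}} (h : ∀ i, OmTreeHom Y (C i)) :
    OmTree.{u} where
  obj n := {p : Y.obj n × Y.obj n // ∀ i, (h i).app n p.1 = (h i).app n p.2}
  res n p := ⟨(Y.res n p.1.1, Y.res n p.1.2), fun i => by
    simp only [← (h i).natural, p.2 i]⟩

theorem eq_of_jointly_monic {I : Type w} {C : I → OmTree.{u}} {h : ∀ i, OmTreeHom Y (C i)}
    (hmono : ∀ (A : OmTree.{u}) (p q : OmTreeHom A Y),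
      (∀ i, p.comp (h i) = q.comp (h i)) → p = q)
    {n : ℕ} {x y : Y.obj n} (hxy : ∀ i, (h i).app n x = (h i).app n y) : x = y := by
  have key := hmono (jointKernelPair h) ⟨fun _ p => p.1.1, fun _ _ => rfl⟩
    ⟨fun _ p => p.1.2, fun _ _ => rfl⟩
    fun i => OmTreeHom.ext (funext fun _ => funext fun p => p.2 i)
  exact congrFun (congrFun (congrArg OmTreeHom.app key) n) ⟨(x, y), hxy⟩

theorem treeDist_eq_sSup_of_jointly_monic (f g : OmTreeHom X Y) {I : Type w}
    {C : I → OmTree.{u}} (h : ∀ i, OmTreeHom Y (C i))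
    (hmono : ∀ (A : OmTree.{u}) (p q : OmTreeHom A Y),
      (∀ i, p.comp (h i) = q.comp (h i)) → p = q) :
    treeDist f g = sSup {x : ℝ | ∃ i : I, x = treeDist (f.comp (h i)) (g.comp (h i))} := by
  apply le_antisymm
  · refine treeDist_le (Real.sSup_nonneg ?_) fun n hn => ?_
    · rintro x ⟨i, rfl⟩
      exact treeDist_nonneg _ _
    · obtain ⟨x, hx⟩ := Function.ne_iff.mp hn
      obtain ⟨i, hi⟩ : ∃ i, (h i).app n (f.app n x) ≠ (h i).app n (g.app n x) := by
        by_contra! hall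
        exact hx (eq_of_jointly_monic hmono hall)
      have hne : (f.comp (h i)).app n ≠ (g.comp (h i)).app n := fun e => hi (congrFun e x)
      refine (zpow_neg_le_treeDist hne).trans (le_csSup ⟨1, ?_⟩ ⟨i, rfl⟩)
      rintro y ⟨j, rfl⟩
      exact treeDist_le_one _ _
  · refine Real.sSup_le ?_ (treeDist_nonneg f g)
    rintro x ⟨i, rfl⟩
    simpa [treeDist_self, treeDist_nonneg] using treeDist_comp_le f g (h i) (h i)

end

/-- The topos of trees `Set^{ω^op}` is a stable M-category with
respect to the metric `treeDist`: each hom-set is a complete, 1-bounded ultrametric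
space, composition is non-expansive, and distances can be computed along jointly
monic families. -/
theorem toposOfTrees_stable_M_category :
    (∀ (X Y : OmTree.{u}) (f g : OmTreeHom X Y), 0 ≤ treeDist f g) ∧
    (∀ (X Y : OmTree.{u}) (f : OmTreeHom X Y), treeDist f f = 0) ∧
    (∀ (X Y : OmTree.{u}) (f g : OmTreeHom X Y), treeDist f g = treeDist g f) ∧
    (∀ (X Y : OmTree.{u}) (f g : OmTreeHom X Y), treeDist f g = 0 → f = g) ∧
    (∀ (X Y : OmTree.{u}) (f g h : OmTreeHom X Y),
      treeDist f h ≤ max (treeDist f g) (treeDist g h)) ∧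
    (∀ (X Y : OmTree.{u}) (f g : OmTreeHom X Y), treeDist f g ≤ 1) ∧
    (∀ (X Y : OmTree.{u}) (u : ℕ → OmTreeHom X Y),
      (∀ ε : ℝ, 0 < ε → ∃ N : ℕ, ∀ m n : ℕ, N ≤ m → N ≤ n → treeDist (u m) (u n) < ε) →
      ∃ f : OmTreeHom X Y, ∀ ε : ℝ, 0 < ε → ∃ N : ℕ, ∀ n : ℕ, N ≤ n → treeDist (u n) f < ε) ∧
    (∀ (X Y Z : OmTree.{u}) (f g : OmTreeHom X Y) (f' g' : OmTreeHom Y Z),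
      treeDist (f.comp f') (g.comp g') ≤ max (treeDist f g) (treeDist f' g')) ∧
    (∀ (X Y : OmTree.{u}) (f g : OmTreeHom X Y) (I : Type w) (_ : Nonempty I)
      (Cob : I → OmTree.{u}) (h : ∀ i : I, OmTreeHom Y (Cob i)),
      (∀ (A : OmTree.{u}) (p q : OmTreeHom A Y),
        (∀ i : I, p.comp (h i) = q.comp (h i)) → p = q) →
      treeDist f g = sSup {x : ℝ | ∃ i : I, x = treeDist (f.comp (h i)) (g.comp (h i))}) := by
  exact ⟨fun _ _ => treeDist_nonneg, fun _ _ => treeDist_self, fun _ _ => treeDist_comm,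
    fun _ _ _ _ => eq_of_treeDist_eq_zero, fun _ _ => treeDist_le_max,
    fun _ _ => treeDist_le_one, fun _ _ => exists_treeDist_limit,
    fun _ _ _ => treeDist_comp_le,
    fun _ _ f g _ _ _ h hmono => treeDist_eq_sSup_of_jointly_monic f g h hmono⟩
end
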